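/- For every integer n ≥ 1, the power I(C_3)^n of the edge ideal of the triangle C_3 — i.e., the n-th power of the ideal (x_1x_2, x_2x_3, x_1x_3) in k[x_1,x_2,x_3] — is bridge-friendly if and only if n ≤ 3. -/

import Mathlib

open scoped Classical

noncomputable section

namespace ChauHaMaithani

variable {V : Type*}

/-- The lcm of a finite set of monomials (exponent vectors): pointwise maximum. -/
def mlcm (σ : Finset (V → ℕ)) : V → ℕ := fun v => σ.sup fun g => g v

/-- `m` is a bridge of `σ`: `m ∈ σ` and dropping `m` does not change the lcm. -/
def IsBridge (σ : Finset (V → ℕ)) (m : V → ℕ) : Prop :=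
  m ∈ σ ∧ mlcm (σ.erase m) = mlcm σ

/-- `m` is a gap of `σ`: `m ∉ σ` and adding `m` does not change the lcm. -/
def IsGap (σ : Finset (V → ℕ)) (m : V → ℕ) : Prop :=
  m ∉ σ ∧ mlcm (insert m σ) = mlcm σ

/-- A total order `≻` on monomials is encoded by a ranking function `ord`:
`m ≻ m'` iff `ord m' < ord m` (injectivity on the generating set is assumed separately).
`m` is a true gap of `σ` if it is a gap and every bridge of `σ ∪ {m}` dominated by `m`
is already a bridge of `σ`. -/
def IsTrueGap (ord : (V → ℕ) → ℕ) (σ : Finset (V → ℕ)) (m : V → ℕ) : Prop :=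
  IsGap σ m ∧ ∀ m', IsBridge (insert m σ) m' → ord m' < ord m → IsBridge σ m'

/-- `σ` is type-1: it has a true gap (in `M`) dominating none of its bridges. -/
def Type1 (M : Finset (V → ℕ)) (ord : (V → ℕ) → ℕ) (σ : Finset (V → ℕ)) : Prop :=
  ∃ m ∈ M, IsTrueGap ord σ m ∧ ∀ b, IsBridge σ b → ¬ ord b < ord m

/-- `σ` is potentially-type-2: it has a bridge dominating none of its true gaps. -/
def PotType2 (M : Finset (V → ℕ)) (ord : (V → ℕ) → ℕ) (σ : Finset (V → ℕ)) : Prop :=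
  ∃ b, IsBridge σ b ∧ ∀ m ∈ M, IsTrueGap ord σ m → ¬ ord m < ord b

/-- `b` is the `≻`-smallest bridge of `σ`. -/
def IsSBridge (ord : (V → ℕ) → ℕ) (σ : Finset (V → ℕ)) (b : V → ℕ) : Prop :=
  IsBridge σ b ∧ ∀ b', IsBridge σ b' → ord b ≤ ord b'

/-- `σ` is type-2. -/
def Type2 (M : Finset (V → ℕ)) (ord : (V → ℕ) → ℕ) (σ : Finset (V → ℕ)) : Prop :=
  PotType2 M ord σ ∧
    ∀ σ' : Finset (V → ℕ), σ' ⊆ M → σ' ≠ σ → PotType2 M ord σ' →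
      ∀ b b', IsSBridge ord σ b → IsSBridge ord σ' b' →
        σ'.erase b' = σ.erase b → ord b < ord b'

/-- `M` (the minimal generating set of a monomial ideal) is bridge-friendly w.r.t. `ord`:
every potentially-type-2 subset is type-2. -/
def BridgeFriendlyWrt (M : Finset (V → ℕ)) (ord : (V → ℕ) → ℕ) : Prop :=
  ∀ σ ⊆ M, PotType2 M ord σ → Type2 M ord σ

/-- `M` is bridge-friendly: bridge-friendly w.r.t. some total order on `M`. -/
def BridgeFriendly (M : Finset (V → ℕ)) : Prop :=
  ∃ ord : (V → ℕ) → ℕ, Set.InjOn ord M ∧ BridgeFriendlyWrt M ord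

/-- `σ = {m_1 ≻ ⋯ ≻ m_k} ⊆ M` is Lyubeznik-critical w.r.t. `ord`: there is no `m ∈ M` with
`m_t ≻ m` and `m ∣ lcm(m_1, …, m_t)` for some `1 < t ≤ k`. -/
def LyubCritical (M : Finset (V → ℕ)) (ord : (V → ℕ) → ℕ) (σ : Finset (V → ℕ)) : Prop :=
  σ ⊆ M ∧ ¬ ∃ m ∈ M, ∃ t ∈ σ, (∃ u ∈ σ, ord t < ord u) ∧ ord m < ord t ∧
      ∀ v, m v ≤ mlcm (σ.filter fun g => ord t ≤ ord g) v

/-- `M` is Lyubeznik: for some total order on `M`, no Lyubeznik-critical subset has a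
bridge (equivalently, the associated Lyubeznik resolution is minimal). -/
def IsLyubeznik (M : Finset (V → ℕ)) : Prop :=
  ∃ ord : (V → ℕ) → ℕ, Set.InjOn ord M ∧
    ∀ σ : Finset (V → ℕ), LyubCritical M ord σ → ∀ b, ¬ IsBridge σ b

/-- The quadratic monomial `xy` attached to an edge `e = {x,y}`. -/
def edgeMon (e : Sym2 V) : V → ℕ := fun v => if v ∈ e then 1 else 0

/-- `mingens(I(G))`: the edge monomials of `G`. -/
def edgeGens [Fintype V] (G : SimpleGraph V) : Finset (V → ℕ) :=
  (Finset.univ.filter fun e : Sym2 V => e ∈ G.edgeSet).image edgeMon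

/-- `mingens(I(G)^n)`: the monomials that are products of `n` edges of `G`. -/
def edgePowGens [Fintype V] (G : SimpleGraph V) (n : ℕ) : Finset (V → ℕ) :=
  (Finset.univ.filter fun f : Fin n → Sym2 V => ∀ i, f i ∈ G.edgeSet).image
    fun f => ∑ i, edgeMon (f i)

/-- A graph is chordal if it contains no induced cycle of length at least 4. -/
def Chordal (G : SimpleGraph V) : Prop :=
  ∀ n, 4 ≤ n → IsEmpty (SimpleGraph.cycleGraph n ↪g G)


/-- Vertex type of the graph `L(a,b,c)`: `Sum.inl 0` is `x`, `Sum.inl 1` is `y`,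
and the remaining summands are the leaves `x_i`, the leaves `y_j`, and the
triangle tips `z_k`. -/
abbrev LV (a b c : ℕ) := Fin 2 ⊕ (Fin a ⊕ Fin b ⊕ Fin c)

/-- The graph `L(a,b,c)`: `c` triangles glued along the common edge `{x,y}`, with
`a` leaves attached to `x` and `b` leaves attached to `y`. -/
def LGraph (a b c : ℕ) : SimpleGraph (LV a b c) :=
  SimpleGraph.fromRel fun u v =>
    (u = Sum.inl 0 ∧ v = Sum.inl 1) ∨
    (∃ i, u = Sum.inl 0 ∧ v = Sum.inr (Sum.inl i)) ∨
    (∃ j, u = Sum.inl 1 ∧ v = Sum.inr (Sum.inr (Sum.inl j))) ∨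
    (∃ k, (u = Sum.inl 0 ∨ u = Sum.inl 1) ∧ v = Sum.inr (Sum.inr (Sum.inr k)))

/-- The graph `BF(T,w)`: attach `w(e)` new triangles along each edge `e` of `T`. -/
def BFGraph {VT : Type} (T : SimpleGraph VT) (w : T.edgeSet → ℕ) :
    SimpleGraph (VT ⊕ (Σ e : T.edgeSet, Fin (w e))) :=
  SimpleGraph.fromRel fun u v =>
    (∃ a b, u = Sum.inl a ∧ v = Sum.inl b ∧ T.Adj a b) ∨
    (∃ (a : VT) (e : T.edgeSet) (i : Fin (w e)), u = Sum.inl a ∧ v = Sum.inr ⟨e, i⟩ ∧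
      a ∈ (e : Sym2 VT))

/-- The kite graph: the diamond (`K₄` minus the edge `{2,3}`) together with a pendant
vertex `4` attached to the degree-two vertex `2`. -/
def kite : SimpleGraph (Fin 5) :=
  SimpleGraph.fromEdgeSet {s(0,1), s(0,2), s(0,3), s(1,2), s(1,3), s(2,4)}

/-- The gem graph: the path `0-1-2-3` together with a vertex `4` adjacent to all of
`0,1,2,3`. -/
def gem : SimpleGraph (Fin 5) :=
  SimpleGraph.fromEdgeSet {s(0,1), s(1,2), s(2,3), s(0,4), s(1,4), s(2,4), s(3,4)}

/-- The tadpole graph: the triangle `0,1,2` with a path `0-3-4` of length 2 attached. -/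
def tadpole : SimpleGraph (Fin 5) :=
  SimpleGraph.fromEdgeSet {s(0,1), s(1,2), s(0,2), s(0,3), s(3,4)}

/-- The butterfly graph: two triangles `0,1,2` and `0,3,4` sharing the vertex `0`. -/
def butterfly : SimpleGraph (Fin 5) :=
  SimpleGraph.fromEdgeSet {s(0,1), s(1,2), s(0,2), s(0,3), s(3,4), s(0,4)}

/-- The net graph: the triangle `0,1,2` with pendant vertices `3,4,5` attached to
`0,1,2` respectively. -/
def net : SimpleGraph (Fin 6) :=
  SimpleGraph.fromEdgeSet {s(0,1), s(1,2), s(0,2), s(0,3), s(1,4), s(2,5)}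

/-! ### Bridges and gaps through divisibility -/

lemma mlcm_insert (σ : Finset (V → ℕ)) (m : V → ℕ) : mlcm (insert m σ) = m ⊔ mlcm σ := by
  funext v
  simp [mlcm]

lemma isBridge_iff {σ : Finset (V → ℕ)} {m : V → ℕ} :
    IsBridge σ m ↔ m ∈ σ ∧ m ≤ mlcm (σ.erase m) := by
  refine and_congr_right fun hm => ?_
  conv_lhs => rw [← Finset.insert_erase hm, mlcm_insert, Finset.erase_insert (by simp)]
  exact eq_comm.trans sup_eq_right

lemma isGap_iff {σ : Finset (V → ℕ)} {m : V → ℕ} :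
    IsGap σ m ↔ m ∉ σ ∧ m ≤ mlcm σ := by
  refine and_congr_right fun _ => ?_
  rw [mlcm_insert]
  exact sup_eq_right

/-! ### Bridge-friendliness as a uniqueness statement -/

/-- Adding `b` to `τ` gives a potentially-type-2 set with smallest bridge `b`. -/
def FreeBridge (M : Finset (V → ℕ)) (ord : (V → ℕ) → ℕ) (τ : Finset (V → ℕ)) (b : V → ℕ) :
    Prop :=
  b ∉ τ ∧ PotType2 M ord (insert b τ) ∧ IsSBridge ord (insert b τ) b

lemma bridgeFriendlyWrt_iff {M : Finset (V → ℕ)} {ord : (V → ℕ) → ℕ} :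
    BridgeFriendlyWrt M ord ↔ ∀ τ ⊆ M, ∀ b ∈ M, ∀ c ∈ M,
      FreeBridge M ord τ b → FreeBridge M ord τ c → b = c := by
  constructor
  · rintro h τ hτ b hb c hc ⟨hbτ, hb2, hbs⟩ ⟨hcτ, hc2, hcs⟩
    by_contra hne
    have hne' : insert c τ ≠ insert b τ := fun he => hne <| by
      have : b ∈ insert c τ := he ▸ Finset.mem_insert_self b τ
      simpa [hbτ] using this
    have hB := (h _ (Finset.insert_subset hb hτ) hb2).2 _ (Finset.insert_subset hc hτ) hne'
      hc2 b c hbs hcs (by simp [hbτ, hcτ])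
    have hC := (h _ (Finset.insert_subset hc hτ) hc2).2 _ (Finset.insert_subset hb hτ) hne'.symm
      hb2 c b hcs hbs (by simp [hbτ, hcτ])
    omega
  · intro h σ hσ hσ2
    refine ⟨hσ2, fun σ' hσ' hne h2 b b' hb hb' he => ?_⟩
    have hbσ := hb.1.1
    have hbσ' := hb'.1.1
    refine absurd ?_ hne
    have : b = b' := by
      refine h (σ.erase b) ((Finset.erase_subset _ _).trans hσ) b (hσ hbσ) b' (hσ' hbσ') ?_ ?_
      · simpa [FreeBridge, Finset.insert_erase hbσ] using ⟨hσ2, hb⟩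
      · rw [← he]
        simpa [FreeBridge, Finset.insert_erase hbσ'] using ⟨h2, hb'⟩
    subst this
    rw [← Finset.insert_erase hbσ, ← Finset.insert_erase hbσ', he]

lemma freeBridge_iff {M : Finset (V → ℕ)} {ord : (V → ℕ) → ℕ} {τ : Finset (V → ℕ)}
    {b : V → ℕ} :
    FreeBridge M ord τ b ↔ b ∉ τ ∧ b ≤ mlcm τ ∧
      (∀ z ∈ τ, z ≤ mlcm (insert b (τ.erase z)) → ord b ≤ ord z) ∧
      ∀ x ∈ M, ord x < ord b → x ∉ τ → x ≤ mlcm τ →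
        ∃ y ∈ τ, ord y < ord x ∧ y ≤ mlcm (insert x (insert b (τ.erase y))) := by
  refine and_congr_right fun hbτ => ?_
  have hz : ∀ z ∈ τ, (insert b τ).erase z = insert b (τ.erase z) := fun z hz =>
    Finset.erase_insert_of_ne fun h => hbτ (h ▸ hz)
  have hbb : IsBridge (insert b τ) b ↔ b ≤ mlcm τ := by
    rw [isBridge_iff, Finset.erase_insert hbτ]
    simp
  have hs : IsSBridge ord (insert b τ) b ↔ b ≤ mlcm τ ∧
      ∀ z ∈ τ, z ≤ mlcm (insert b (τ.erase z)) → ord b ≤ ord z := by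
    refine and_congr hbb ⟨fun h z hzτ hle => h z ?_, fun h z hzb => ?_⟩
    · rw [isBridge_iff, hz z hzτ]
      exact ⟨Finset.mem_insert_of_mem hzτ, hle⟩
    · obtain ⟨hmem, hle⟩ := isBridge_iff.1 hzb
      obtain rfl | hzτ := Finset.mem_insert.1 hmem
      · exact le_rfl
      · exact h z hzτ (hz z hzτ ▸ hle)
  rw [← and_assoc, ← hs, and_comm]
  refine and_congr_right fun hsb => ?_
  have hsup : mlcm (insert b τ) = mlcm τ := by
    rw [mlcm_insert]
    exact sup_eq_right.2 (hbb.1 hsb.1)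
  constructor
  · rintro ⟨b₀, hb₀, hgap⟩ x hxM hxb hxτ hxle
    have hne : x ≠ b := fun h => by simp [h] at hxb
    have hnot : ¬ IsTrueGap ord (insert b τ) x := fun h =>
      hgap x hxM h (hxb.trans_le (hsb.2 b₀ hb₀))
    have hg : IsGap (insert b τ) x := by
      rw [isGap_iff, hsup]
      exact ⟨by simp [hne, hxτ], hxle⟩
    simp only [IsTrueGap, hg, true_and, not_forall] at hnot
    obtain ⟨y, hy, hyx, -⟩ := hnot
    obtain ⟨hmem, hle⟩ := isBridge_iff.1 hy
    have hyx' : x ≠ y := fun h => by simp [h] at hyx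
    have hyb' : b ≠ y := fun h => by
      subst h
      omega
    have hyτ : y ∈ τ := by simpa [hyx'.symm, hyb'.symm] using hmem
    rw [Finset.erase_insert_of_ne hyx', Finset.erase_insert_of_ne hyb'] at hle
    exact ⟨y, hyτ, hyx, hle⟩
  · intro h
    refine ⟨b, hsb.1, fun x hxM hx hxb => ?_⟩
    obtain ⟨hxm, hxle⟩ := isGap_iff.1 hx.1
    rw [Finset.mem_insert, not_or] at hxm
    obtain ⟨y, hyτ, hyx, hle⟩ := h x hxM hxb hxm.2 (hsup ▸ hxle)
    have hyx' : x ≠ y := fun h => by simp [h] at hyx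
    have hyb' : b ≠ y := fun h => hbτ (h ▸ hyτ)
    have := hsb.2 y <| hx.2 y (isBridge_iff.2 ⟨by simp [hyτ], by
      rwa [Finset.erase_insert_of_ne hyx', Finset.erase_insert_of_ne hyb']⟩) hyx
    omega

/-! ### Transport to an indexed family -/

/-- The monomial `q i` divides the lcm of the monomials `q j`, `j ∈ T`. -/
def Covers {ι : Type*} (q : ι → V → ℕ) (T : Finset ι) (i : ι) : Prop :=
  ∀ v, ∃ j ∈ T, q i v ≤ q j v

/-- `FreeBridge` for sets of indices of a family `q` of monomials ranked by `r`. -/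
def FreeBridgeIdx {ι : Type*} [DecidableEq ι] (q : ι → V → ℕ) (r : ι → ℕ) (T : Finset ι)
    (b : ι) : Prop :=
  b ∉ T ∧ Covers q T b ∧ (∀ z ∈ T, Covers q (insert b (T.erase z)) z → r b ≤ r z) ∧
    ∀ x, r x < r b → x ∉ T → Covers q T x →
      ∃ y ∈ T, r y < r x ∧ Covers q (insert x (insert b (T.erase y))) y

instance {ι : Type*} [Fintype V] (q : ι → V → ℕ) (T : Finset ι) (i : ι) :
    Decidable (Covers q T i) := by
  unfold Covers
  infer_instance

instance {ι : Type*} [DecidableEq ι] [Fintype ι] [Fintype V] (q : ι → V → ℕ) (r : ι → ℕ)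
    (T : Finset ι) (b : ι) : Decidable (FreeBridgeIdx q r T b) := by
  unfold FreeBridgeIdx
  infer_instance

lemma le_mlcm_image_iff {ι : Type*} {p q : ι → V → ℕ} (hp : ∀ i, p i ≠ 0)
    (hpq : ∀ i j v, p i v ≤ p j v ↔ q i v ≤ q j v) (T : Finset ι) (i : ι) :
    p i ≤ mlcm (T.image p) ↔ Covers q T i := by
  simp only [Covers, ← hpq]
  have hpos : ∀ v, p i v ≠ 0 → (p i v ≤ mlcm (T.image p) v ↔ ∃ j ∈ T, p i v ≤ p j v) := by
    intro v hv
    simp [mlcm, Finset.le_sup_iff (Nat.pos_of_ne_zero hv)]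
  obtain ⟨w, hw⟩ := Function.ne_iff.1 (hp i)
  constructor
  · intro h v
    by_cases hv : p i v = 0
    · obtain ⟨j, hj, -⟩ := (hpos w hw).1 (h w)
      exact ⟨j, hj, hv ▸ Nat.zero_le _⟩
    · exact (hpos v hv).1 (h v)
  · intro h v
    by_cases hv : p i v = 0
    · exact hv ▸ Nat.zero_le _
    · exact (hpos v hv).2 (h v)

lemma freeBridge_image_iff {ι : Type*} [DecidableEq ι] {M : Finset (V → ℕ)}
    {ord : (V → ℕ) → ℕ} {p q : ι → V → ℕ} (hp : ∀ i, p i ≠ 0) (hinj : Function.Injective p)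
    (hpq : ∀ i j v, p i v ≤ p j v ↔ q i v ≤ q j v) (hpM : ∀ i, p i ∈ M)
    (hM : ∀ m ∈ M, (∀ v, ∃ i, m v ≤ p i v) → ∃ i, p i = m) {T : Finset ι} {b : ι} :
    FreeBridge M ord (T.image p) (p b) ↔ FreeBridgeIdx q (fun i => ord (p i)) T b := by
  have hcov := le_mlcm_image_iff hp hpq
  have hmem : ∀ {i : ι} {S : Finset ι}, p i ∈ S.image p ↔ i ∈ S := by
    simp [hinj.eq_iff]
  rw [freeBridge_iff, FreeBridgeIdx]
  simp only [hmem, hcov, Finset.forall_mem_image, Finset.exists_mem_image,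
    ← Finset.image_erase hinj, ← Finset.image_insert]
  refine and_congr_right fun _ => and_congr_right fun hb => and_congr_right fun _ => ?_
  constructor
  · intro h x hxb hxT hx
    have := h (p x) (hpM x) hxb (hmem.not.2 hxT) ((hcov T x).2 hx)
    simpa only [← Finset.image_insert, hcov] using this
  · intro h m hm hmb hmT hmle
    obtain ⟨x, rfl⟩ := hM m hm fun v => by
      obtain ⟨j, hj, -⟩ := hb v
      obtain ⟨g, hg, hgv⟩ := Finset.exists_mem_eq_sup (T.image p) ⟨p j, hmem.2 hj⟩ fun g => g v
      obtain ⟨i, -, rfl⟩ := Finset.mem_image.1 hg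
      exact ⟨i, (hmle v).trans hgv.le⟩
    have := h x hmb (hmem.not.1 hmT) ((hcov T x).1 hmle)
    simpa only [← Finset.image_insert, hcov] using this

lemma BridgeFriendlyWrt.freeBridgeIdx_unique {ι : Type*} [DecidableEq ι]
    {M : Finset (V → ℕ)} {ord : (V → ℕ) → ℕ} (h : BridgeFriendlyWrt M ord)
    {p q : ι → V → ℕ} (hp : ∀ i, p i ≠ 0) (hinj : Function.Injective p)
    (hpq : ∀ i j v, p i v ≤ p j v ↔ q i v ≤ q j v) (hpM : ∀ i, p i ∈ M)
    (hM : ∀ m ∈ M, (∀ v, ∃ i, m v ≤ p i v) → ∃ i, p i = m) (T : Finset ι) (b c : ι)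
    (hb : FreeBridgeIdx q (fun i => ord (p i)) T b)
    (hc : FreeBridgeIdx q (fun i => ord (p i)) T c) : b = c := by
  refine hinj (bridgeFriendlyWrt_iff.1 h (T.image p) ?_ _ (hpM b) _ (hpM c)
    ((freeBridge_image_iff hp hinj hpq hpM hM).2 hb)
    ((freeBridge_image_iff hp hinj hpq hpM hM).2 hc))
  simpa [Finset.image_subset_iff] using fun i _ => hpM i

lemma bridgeFriendly_of_freeBridgeIdx_unique {N : ℕ} [NeZero N] {M : Finset (V → ℕ)}
    {p : Fin N → V → ℕ} (hp : ∀ i, p i ≠ 0) (hinj : Function.Injective p)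
    (hM : ∀ m, m ∈ M ↔ ∃ i, p i = m)
    (h : ∀ T b c, FreeBridgeIdx p Fin.val T b → FreeBridgeIdx p Fin.val T c → b = c) :
    BridgeFriendly M := by
  have hinv : ∀ i, Function.invFun p (p i) = i := Function.leftInverse_invFun hinj
  have hpM : ∀ i, p i ∈ M := fun i => (hM _).2 ⟨i, rfl⟩
  refine ⟨fun m => (Function.invFun p m : Fin N), ?_, bridgeFriendlyWrt_iff.2 ?_⟩
  · intro m hm m' hm' he
    obtain ⟨i, rfl⟩ := (hM _).1 hm
    obtain ⟨j, rfl⟩ := (hM _).1 hm'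
    simpa [hinv, Fin.val_inj, hinj.eq_iff] using he
  · intro τ hτ m hm m' hm' hb hc
    obtain ⟨b, rfl⟩ := (hM _).1 hm
    obtain ⟨c, rfl⟩ := (hM _).1 hm'
    obtain ⟨T, rfl⟩ : ∃ T : Finset (Fin N), T.image p = τ := by
      refine ⟨Finset.univ.filter fun i => p i ∈ τ, ?_⟩
      ext m
      simp only [Finset.mem_image, Finset.mem_filter, Finset.mem_univ, true_and]
      refine ⟨?_, fun hm => ?_⟩
      · rintro ⟨i, hi, rfl⟩
        exact hi
      · obtain ⟨i, rfl⟩ := (hM m).1 (hτ hm)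
        exact ⟨i, hm, rfl⟩
    rw [freeBridge_image_iff hp hinj (fun _ _ _ => Iff.rfl) hpM fun m hm _ => (hM m).1 hm]
      at hb hc
    simp only [hinv] at hb hc
    rw [h T b c hb hc]

/-! ### Index sets as bit masks -/

/-- `Covers` for the index set with bit mask `s`; the mask `up i v` lists the `j` with
`q i v ≤ q j v`. -/
def CoversMask (up : ℕ → ℕ → ℕ) (s i : ℕ) : Prop :=
  s &&& up i 0 ≠ 0 ∧ s &&& up i 1 ≠ 0 ∧ s &&& up i 2 ≠ 0

instance (up : ℕ → ℕ → ℕ) (s i : ℕ) : Decidable (CoversMask up s i) := by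
  unfold CoversMask
  infer_instance

/-- `FreeBridgeIdx` for the index set with bit mask `s`, ranked by the indices. -/
def FreeBridgeMask (up : ℕ → ℕ → ℕ) (s b : ℕ) : Prop :=
  s.testBit b = false ∧ CoversMask up s b ∧
    (∀ z < b, s.testBit z = true → ¬ CoversMask up ((s ^^^ 2 ^ z) ||| 2 ^ b) z) ∧
    ∀ x < b, s.testBit x = false → CoversMask up s x → ∃ y < x, s.testBit y = true ∧
      CoversMask up (((s ^^^ 2 ^ y) ||| 2 ^ b) ||| 2 ^ x) y

instance (up : ℕ → ℕ → ℕ) (s b : ℕ) : Decidable (FreeBridgeMask up s b) := by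
  unfold FreeBridgeMask
  infer_instance

lemma land_ne_zero_iff {s t : ℕ} : s &&& t ≠ 0 ↔ ∃ k, s.testBit k ∧ t.testBit k := by
  constructor
  · intro h
    obtain ⟨k, hk⟩ := Nat.exists_testBit_of_ne_zero h
    exact ⟨k, by simpa using hk⟩
  · rintro ⟨k, hs, ht⟩ h
    have := congrArg (fun m : ℕ => m.testBit k) h
    simp [hs, ht] at this

lemma freeBridgeIdx_iff_mask {N : ℕ} {q : Fin N → Fin 3 → ℕ} {up : ℕ → ℕ → ℕ}
    (hup : ∀ (i : Fin N) (v : Fin 3), up i v = Nat.ofBits fun j => decide (q i v ≤ q j v))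
    {T : Finset (Fin N)} {s : ℕ} (hs : ∀ i : Fin N, i ∈ T ↔ s.testBit i = true) (b : Fin N) :
    FreeBridgeIdx q Fin.val T b ↔ FreeBridgeMask up s b := by
  have hcov : ∀ {S : Finset (Fin N)} {t : ℕ}, (∀ i : Fin N, i ∈ S ↔ t.testBit i = true) →
      ∀ i, Covers q S i ↔ CoversMask up t i := by
    intro S t hS i
    have hv : ∀ v, (∃ j ∈ S, q i v ≤ q j v) ↔ t &&& up i v ≠ 0 := by
      intro v
      rw [land_ne_zero_iff, hup]
      constructor
      · rintro ⟨j, hj, hle⟩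
        exact ⟨j, (hS j).1 hj, by simpa [Nat.testBit_ofBits_lt] using hle⟩
      · rintro ⟨k, hk, hle⟩
        have hkN : k < N := by
          by_contra hkN
          simp [Nat.testBit_ofBits_ge _ _ (not_lt.1 hkN)] at hle
        exact ⟨⟨k, hkN⟩, (hS ⟨k, hkN⟩).2 hk, by
          simpa [Nat.testBit_ofBits_lt _ _ hkN] using hle⟩
    simp only [Covers, CoversMask, hv, Fin.forall_fin_succ, IsEmpty.forall_iff, and_true]
    rfl
  have hins : ∀ {S : Finset (Fin N)} {t : ℕ}, (∀ i : Fin N, i ∈ S ↔ t.testBit i = true) →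
      ∀ b i : Fin N, i ∈ insert b S ↔ (t ||| 2 ^ b.val).testBit i = true := by
    intro S t hS b i
    rw [Finset.mem_insert, hS, Nat.testBit_or, Nat.testBit_two_pow, Bool.or_eq_true,
      decide_eq_true_iff, Fin.ext_iff, or_comm, eq_comm (a := i.val)]
  have hers : ∀ z ∈ T, ∀ i, i ∈ T.erase z ↔ (s ^^^ 2 ^ z.val).testBit i = true := by
    intro z hz i
    by_cases hiz : i = z
    · subst hiz
      simp [(hs i).1 hz]
    · have : z.val ≠ i.val := fun h => hiz (Fin.ext h.symm)
      simp [hs, hiz, this]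
  have hns : ∀ i : Fin N, i ∉ T ↔ s.testBit i = false := by simp [hs]
  refine and_congr (hns b) (and_congr (hcov hs b) (and_congr ?_ ?_))
  · constructor
    · intro h z hzb hz hc
      have hzT := (hs ⟨z, hzb.trans b.2⟩).2 hz
      exact absurd (h _ hzT ((hcov (hins (hers _ hzT) b) _).2 hc)) (not_le.2 hzb)
    · intro h z hz hc
      by_contra hzb
      exact h z (not_le.1 hzb) ((hs z).1 hz) ((hcov (hins (hers z hz) b) z).1 hc)
  · constructor
    · intro h x hxb hx hc
      obtain ⟨y, hy, hyx, hcy⟩ := h ⟨x, hxb.trans b.2⟩ hxb ((hns _).2 hx) ((hcov hs _).2 hc)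
      exact ⟨y, hyx, (hs y).1 hy, (hcov (hins (hins (hers y hy) b) _) y).1 hcy⟩
    · intro h x hxb hx hc
      obtain ⟨y, hyx, hy, hcy⟩ := h x hxb ((hns x).1 hx) ((hcov hs x).1 hc)
      have hyT := (hs ⟨y, hyx.trans x.2⟩).2 hy
      exact ⟨⟨y, hyx.trans x.2⟩, hyT, hyx, (hcov (hins (hins (hers _ hyT) b) x) _).2 hcy⟩

lemma freeBridgeIdx_unique_of_mask {N : ℕ} {q : Fin N → Fin 3 → ℕ} {up : ℕ → ℕ → ℕ}
    (hup : ∀ (i : Fin N) (v : Fin 3), up i v = Nat.ofBits fun j => decide (q i v ≤ q j v))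
    (h : ∀ s < 2 ^ N, ∀ b < N, FreeBridgeMask up s b → ∀ c < b, ¬ FreeBridgeMask up s c)
    (T : Finset (Fin N)) (b c : Fin N) (hb : FreeBridgeIdx q Fin.val T b)
    (hc : FreeBridgeIdx q Fin.val T c) : b = c := by
  have hs : ∀ i : Fin N, i ∈ T ↔
      (Nat.ofBits fun j : Fin N => decide (j ∈ T)).testBit i = true := by
    simp [Nat.testBit_ofBits_lt]
  rw [freeBridgeIdx_iff_mask hup hs] at hb hc
  obtain hlt | rfl | hlt := lt_trichotomy b c
  · exact (h _ (Nat.ofBits_lt_two_pow _) c c.2 hc _ hlt hb).elim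
  · rfl
  · exact (h _ (Nat.ofBits_lt_two_pow _) b b.2 hb _ hlt hc).elim

/-! ### Powers of the triangle -/

/-- The deficiency vectors of total weight two, the first one being a corner. -/
def defect : Fin 6 → Fin 3 → ℕ :=
  ![![0, 0, 2], ![1, 0, 1], ![0, 1, 1], ![1, 1, 0], ![2, 0, 0], ![0, 2, 0]]

/-- The monomials of degree four with deficiencies `defect`. -/
def tri (x : Fin 6) (v : Fin 3) : ℕ := 2 - defect x v

lemma forall_fin_six {P : Fin 6 → Prop} :
    (∀ x, P x) ↔ P 0 ∧ P 1 ∧ P 2 ∧ P 3 ∧ P 4 ∧ P 5 := by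
  simp [Fin.forall_fin_succ]

lemma exists_fin_six {P : Fin 6 → Prop} :
    (∃ x, P x) ↔ P 0 ∨ P 1 ∨ P 2 ∨ P 3 ∨ P 4 ∨ P 5 := by
  simp [Fin.exists_fin_succ]

set_option maxHeartbeats 1600000 in
/-- In a bridge-friendly order of the monomials `tri`, the corner is not smaller than both of
its neighbours. -/
lemma corner_not_least (r : Fin 6 → ℕ) (hr : Function.Injective r)
    (h : ∀ T b c, FreeBridgeIdx tri r T b → FreeBridgeIdx tri r T c → b = c)
    (hA : r 0 < r 1) (hB : r 0 < r 2) : False := by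
  have key : ∀ T b c, b ≠ c → ¬ (FreeBridgeIdx tri r T b ∧ FreeBridgeIdx tri r T c) :=
    fun T b c hne hbc => hne (h T b c hbc.1 hbc.2)
  have h12 := key {0, 3} 1 2 (by decide)
  have h14 := key {0, 3} 1 4 (by decide)
  have h15 := key {0, 3} 1 5 (by decide)
  have h24 := key {0, 3} 2 4 (by decide)
  have h25 := key {0, 3} 2 5 (by decide)
  have h45 := key {0, 3} 4 5 (by decide)
  have g1 := key {4, 2} 0 3 (by decide)
  have g2 := key {4, 2} 0 5 (by decide)
  have k1 := key {1, 5} 0 3 (by decide)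
  have k2 := key {1, 5} 0 4 (by decide)
  simp (decide := true) only [FreeBridgeIdx, forall_fin_six, exists_fin_six, true_and, and_true,
    false_and, and_false, or_false, false_or, forall_const, false_implies, implies_true]
    at h12 h14 h15 h24 h25 h45 g1 g2 k1 k2
  have a1 := hr.ne (show (0 : Fin 6) ≠ 3 by decide)
  have a2 := hr.ne (show (0 : Fin 6) ≠ 4 by decide)
  have a3 := hr.ne (show (0 : Fin 6) ≠ 5 by decide)
  have a4 := hr.ne (show (1 : Fin 6) ≠ 2 by decide)
  have a5 := hr.ne (show (1 : Fin 6) ≠ 3 by decide)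
  have a6 := hr.ne (show (1 : Fin 6) ≠ 4 by decide)
  have a7 := hr.ne (show (1 : Fin 6) ≠ 5 by decide)
  have a8 := hr.ne (show (2 : Fin 6) ≠ 3 by decide)
  have a9 := hr.ne (show (2 : Fin 6) ≠ 4 by decide)
  have a10 := hr.ne (show (2 : Fin 6) ≠ 5 by decide)
  have a11 := hr.ne (show (3 : Fin 6) ≠ 4 by decide)
  have a12 := hr.ne (show (3 : Fin 6) ≠ 5 by decide)
  have a13 := hr.ne (show (4 : Fin 6) ≠ 5 by decide)
  clear hr h key
  generalize r 0 = C at *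
  generalize r 1 = A at *
  generalize r 2 = B at *
  generalize r 3 = c at *
  generalize r 4 = X at *
  generalize r 5 = Y at *
  grind (splits := 40)

lemma forall_fin_three {P : Fin 3 → Prop} : (∀ x, P x) ↔ P 0 ∧ P 1 ∧ P 2 := by
  simp [Fin.forall_fin_succ]

lemma mem_edgePowGens_zero {W : Type*} [Fintype W] (G : SimpleGraph W) {m : W → ℕ} :
    m ∈ edgePowGens G 0 ↔ m = 0 := by
  simp [edgePowGens]

lemma mem_edgePowGens_succ {W : Type*} [Fintype W] (G : SimpleGraph W) {n : ℕ} {m : W → ℕ} :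
    m ∈ edgePowGens G (n + 1) ↔
      ∃ e ∈ G.edgeSet, ∃ m' ∈ edgePowGens G n, edgeMon e + m' = m := by
  simp only [edgePowGens, Finset.mem_image, Finset.mem_filter, Finset.mem_univ, true_and]
  constructor
  · rintro ⟨f, hf, rfl⟩
    exact ⟨f 0, hf 0, _, ⟨fun i => f i.succ, fun i => hf _, rfl⟩,
      (Fin.sum_univ_succ fun i => edgeMon (f i)).symm⟩
  · rintro ⟨e, he, _, ⟨f, hf, rfl⟩, rfl⟩
    refine ⟨Fin.cons e f, fun i => ?_, by simp [Fin.sum_univ_succ]⟩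
    cases i using Fin.cases with
    | zero => exact he
    | succ i => exact hf i

lemma mem_edgePowGens_cycleGraph_three {n : ℕ} {m : Fin 3 → ℕ} :
    m ∈ edgePowGens (SimpleGraph.cycleGraph 3) n ↔
      m 0 + m 1 + m 2 = 2 * n ∧ ∀ v, m v ≤ n := by
  induction n generalizing m with
  | zero =>
    rw [mem_edgePowGens_zero, funext_iff, forall_fin_three, forall_fin_three]
    simp only [Pi.zero_apply]
    omega
  | succ n ih =>
    have hadj : ∀ i j : Fin 3, s(i, j) ∈ (SimpleGraph.cycleGraph 3).edgeSet ↔ i ≠ j := by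
      simp [SimpleGraph.cycleGraph_three_eq_top]
    simp only [mem_edgePowGens_succ, ih, forall_fin_three]
    constructor
    · rintro ⟨e, he, m', h, rfl⟩
      induction e with | _ i j
      have hij := (hadj i j).1 he
      fin_cases i <;> fin_cases j <;> simp [edgeMon] at hij ⊢ <;> omega
    · rintro ⟨hsum, h0, h1, h2⟩
      have key : ∀ i j : Fin 3, i ≠ j → edgeMon s(i, j) ≤ m →
          (∀ v, m v ≤ n + edgeMon s(i, j) v) →
          ∃ e ∈ (SimpleGraph.cycleGraph 3).edgeSet, ∃ m', (m' 0 + m' 1 + m' 2 = 2 * n ∧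
            m' 0 ≤ n ∧ m' 1 ≤ n ∧ m' 2 ≤ n) ∧ edgeMon e + m' = m := by
        intro i j hij hle hn
        have hs : edgeMon s(i, j) 0 + edgeMon s(i, j) 1 + edgeMon s(i, j) 2 = 2 := by
          fin_cases i <;> fin_cases j <;> simp [edgeMon] at hij ⊢
        refine ⟨s(i, j), (hadj i j).2 hij, m - edgeMon s(i, j), ?_, add_tsub_cancel_of_le hle⟩
        have a0 := hle 0; have a1 := hle 1; have a2 := hle 2
        have b0 := hn 0; have b1 := hn 1; have b2 := hn 2
        simp only [Pi.sub_apply]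
        omega
      obtain h | h | h : (m 0 ≤ m 1 ∧ m 0 ≤ m 2) ∨ (m 1 ≤ m 0 ∧ m 1 ≤ m 2) ∨
          (m 2 ≤ m 0 ∧ m 2 ≤ m 1) := by omega
      · refine key 1 2 (by decide) ?_ ?_ <;>
          simp [Pi.le_def, forall_fin_three, edgeMon] <;> omega
      · refine key 0 2 (by decide) ?_ ?_ <;>
          simp [Pi.le_def, forall_fin_three, edgeMon] <;> omega
      · refine key 0 1 (by decide) ?_ ?_ <;>
          simp [Pi.le_def, forall_fin_three, edgeMon] <;> omega

lemma corner_not_least_of_perm {n : ℕ} {ord : (Fin 3 → ℕ) → ℕ}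
    (hinj : Set.InjOn ord (edgePowGens (SimpleGraph.cycleGraph 3) n))
    (h : BridgeFriendlyWrt (edgePowGens (SimpleGraph.cycleGraph 3) n) ord)
    (e : Equiv.Perm (Fin 3)) {L : Fin 3 → ℕ} (hL : ∀ v, 3 ≤ L v) (hLn : ∀ v, L v ≤ n)
    (hsum : L 0 + L 1 + L 2 = 2 * n + 2) {a b c : Fin 3 → ℕ}
    (ha : ∀ v, a v = L v - defect 0 (e v)) (hb : ∀ v, b v = L v - defect 1 (e v))
    (hc : ∀ v, c v = L v - defect 2 (e v)) (hab : ord a < ord b) (hac : ord a < ord c) :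
    False := by
  have hd : ∀ x v, defect x v ≤ 2 := by decide
  have hds : ∀ x, defect x (e 0) + defect x (e 1) + defect x (e 2) = 2 := by
    intro x
    have : ∑ v, defect x (e v) = 2 := by
      rw [Equiv.sum_comp e (defect x)]
      revert x
      decide
    simpa [Fin.sum_univ_three] using this
  have hdinj : ∀ x y, (∀ v, defect x v = defect y v) → x = y := by decide
  have hdsurj : ∀ d0 d1 d2 : Fin 3, (d0 + d1 + d2 : ℕ) = 2 →
      ∃ x, defect x 0 = d0 ∧ defect x 1 = d1 ∧ defect x 2 = d2 := by decide +kernel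
  set p : Fin 6 → Fin 3 → ℕ := fun x v => L v - defect x (e v) with hp
  have hpinj : Function.Injective p := by
    intro x y hxy
    refine hdinj x y fun v => ?_
    have h1 := congrFun hxy (e.symm v)
    have h2 := hd x v
    have h3 := hd y v
    have h4 := hL (e.symm v)
    simp only [hp, Equiv.apply_symm_apply] at h1
    omega
  have hpM : ∀ x, p x ∈ edgePowGens (SimpleGraph.cycleGraph 3) n := by
    intro x
    rw [mem_edgePowGens_cycleGraph_three]
    refine ⟨?_, fun v => (Nat.sub_le _ _).trans (hLn v)⟩
    have := hds x
    have h0 := hd x (e 0); have h1 := hd x (e 1); have h2 := hd x (e 2)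
    have l0 := hL 0; have l1 := hL 1; have l2 := hL 2
    simp only [hp]
    omega
  have hcov : ∀ (T : Finset (Fin 6)) x,
      Covers (fun x v => tri x (e v)) T x ↔ Covers tri T x := fun T x =>
    e.forall_congr_left.trans (by simp [Covers])
  refine corner_not_least (fun x => ord (p x)) (fun x y hxy => hpinj (hinj (hpM x) (hpM y) hxy))
    (fun T x y hx hy => ?_) ?_ ?_
  · refine h.freeBridgeIdx_unique (q := fun x v => tri x (e v)) ?_ hpinj ?_ hpM ?_ T x y ?_ ?_
    · intro x hx
      have := congrFun hx 0
      have := hd x (e 0)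
      have := hL 0
      simp only [hp, Pi.zero_apply] at *
      omega
    · intro x y v
      have := hd x (e v)
      have := hd y (e v)
      have := hL v
      simp only [hp, tri]
      omega
    · intro m hm hle
      have hmL : ∀ v, m v ≤ L v := fun v => by
        obtain ⟨i, hi⟩ := hle v
        exact hi.trans (Nat.sub_le _ _)
      obtain ⟨hms, -⟩ := mem_edgePowGens_cycleGraph_three.1 hm
      have h0 := hmL 0; have h1 := hmL 1; have h2 := hmL 2
      have hs : ∑ v, (L v - m v) = 2 := by
        rw [Fin.sum_univ_three]
        omega
      rw [← Equiv.sum_comp e.symm (fun v => L v - m v), Fin.sum_univ_three] at hs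
      obtain ⟨x, hx⟩ := hdsurj ⟨_, by omega⟩ ⟨_, by omega⟩ ⟨_, by omega⟩ hs
      refine ⟨x, funext fun v => ?_⟩
      have hxv : ∀ v, defect x v = L (e.symm v) - m (e.symm v) := forall_fin_three.2 hx
      have := hmL v
      simp only [hp, hxv, Equiv.symm_apply_apply]
      omega
    all_goals simpa only [FreeBridgeIdx, hcov]
  · rw [show p 0 = a from funext fun v => (ha v).symm,
      show p 1 = b from funext fun v => (hb v).symm]
    exact hab
  · rw [show p 0 = a from funext fun v => (ha v).symm,
      show p 2 = c from funext fun v => (hc v).symm]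
    exact hac

lemma not_bridgeFriendly_of_four_le {n : ℕ} (hn : 4 ≤ n) :
    ¬ BridgeFriendly (edgePowGens (SimpleGraph.cycleGraph 3) n) := by
  rintro ⟨ord, hinj, h⟩
  obtain ⟨k, rfl⟩ := Nat.exists_eq_add_of_le hn
  set α : Fin 3 → ℕ := ![2, k + 3, k + 3] with hα
  set β : Fin 3 → ℕ := ![3, k + 2, k + 3] with hβ
  set γ : Fin 3 → ℕ := ![3, k + 3, k + 2] with hγ
  have hmem : ∀ m ∈ ({α, β, γ} : Set (Fin 3 → ℕ)),
      m ∈ edgePowGens (SimpleGraph.cycleGraph 3) (4 + k) := by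
    rintro m (rfl | rfl | rfl) <;>
      simp [hα, hβ, hγ, mem_edgePowGens_cycleGraph_three, forall_fin_three] <;> omega
  have hαβ : ord α ≠ ord β := hinj.ne (hmem _ (by simp)) (hmem _ (by simp)) fun he => by
    simpa [hα, hβ] using congrFun he 0
  have hαγ : ord α ≠ ord γ := hinj.ne (hmem _ (by simp)) (hmem _ (by simp)) fun he => by
    simpa [hα, hγ] using congrFun he 0
  have hβγ : ord β ≠ ord γ := hinj.ne (hmem _ (by simp)) (hmem _ (by simp)) fun he => by
    simpa [hβ, hγ] using congrFun he 1
  obtain ⟨h1, h2⟩ | ⟨h1, h2⟩ | ⟨h1, h2⟩ : (ord α < ord β ∧ ord α < ord γ) ∨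
      (ord β < ord α ∧ ord β < ord γ) ∨ (ord γ < ord α ∧ ord γ < ord β) := by omega
  · refine corner_not_least_of_perm hinj h (Equiv.swap 0 2) (L := ![4, k + 3, k + 3])
      ?_ ?_ ?_ ?_ ?_ ?_ h2 h1 <;>
      simp [forall_fin_three, defect, Equiv.swap_apply_def, hα, hβ, hγ] <;> omega
  · refine corner_not_least_of_perm hinj h (Equiv.swap 1 2) (L := ![3, k + 4, k + 3])
      ?_ ?_ ?_ ?_ ?_ ?_ h1 h2 <;>
      simp [forall_fin_three, defect, Equiv.swap_apply_def, hα, hβ, hγ] <;> omega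
  · refine corner_not_least_of_perm hinj h 1 (L := ![3, k + 3, k + 4])
      ?_ ?_ ?_ ?_ ?_ ?_ h1 h2 <;>
      simp [forall_fin_three, defect, hα, hβ, hγ] <;> omega

/-- The generators of the cube of the edge ideal of the triangle, in bridge-friendly order. -/
def cubeGens : Fin 10 → Fin 3 → ℕ :=
  ![![2, 2, 2], ![1, 3, 2], ![0, 3, 3], ![2, 1, 3], ![1, 2, 3], ![2, 3, 1], ![3, 0, 3],
    ![3, 1, 2], ![3, 2, 1], ![3, 3, 0]]

/-- The mask of the `j` with `cubeGens i v ≤ cubeGens j v`; these masks are precomputed, as the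
base-`2 ^ 10` digits of a numeral. -/
def cubeMask (i v : ℕ) : ℕ :=
  2036116973479864384371239214914435658452582903934592412310608024624132007349166325244944361
    >>> (10 * (3 * i + v)) % 1024

lemma cubeMask_eq : ∀ (i : Fin 10) (v : Fin 3),
    cubeMask i v = Nat.ofBits fun j => decide (cubeGens i v ≤ cubeGens j v) := by
  decide +kernel

lemma freeBridgeMask_cubeMask_unique : ∀ s < 2 ^ 10, ∀ b < 10, FreeBridgeMask cubeMask s b →
    ∀ c < b, ¬ FreeBridgeMask cubeMask s c := by
  decide +kernel

lemma bridgeFriendly_one : BridgeFriendly (edgePowGens (SimpleGraph.cycleGraph 3) 1) := by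
  refine bridgeFriendly_of_freeBridgeIdx_unique
    (p := (![![1, 1, 0], ![1, 0, 1], ![0, 1, 1]] : Fin 3 → Fin 3 → ℕ))
    (by decide +kernel) (by decide +kernel) (fun m => ?_) (by decide +kernel)
  rw [mem_edgePowGens_cycleGraph_three]
  simp only [Fin.exists_fin_succ, funext_iff, forall_fin_three]
  simp
  omega

lemma bridgeFriendly_two : BridgeFriendly (edgePowGens (SimpleGraph.cycleGraph 3) 2) := by
  refine bridgeFriendly_of_freeBridgeIdx_unique
    (p := (![![2, 1, 1], ![2, 2, 0], ![2, 0, 2], ![1, 2, 1], ![1, 1, 2], ![0, 2, 2]] :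
      Fin 6 → Fin 3 → ℕ))
    (by decide +kernel) (by decide +kernel) (fun m => ?_) (by decide +kernel)
  rw [mem_edgePowGens_cycleGraph_three]
  simp only [Fin.exists_fin_succ, funext_iff, forall_fin_three]
  simp
  omega

lemma bridgeFriendly_three : BridgeFriendly (edgePowGens (SimpleGraph.cycleGraph 3) 3) := by
  refine bridgeFriendly_of_freeBridgeIdx_unique (p := cubeGens)
    (by decide +kernel) (by decide +kernel) (fun m => ?_)
    (freeBridgeIdx_unique_of_mask cubeMask_eq freeBridgeMask_cubeMask_unique)
  rw [mem_edgePowGens_cycleGraph_three]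
  simp only [Fin.exists_fin_succ, funext_iff, forall_fin_three, cubeGens]
  constructor
  · rintro ⟨hsum, h0, h1, h2⟩
    obtain ⟨h, h'⟩ : m 2 = 6 - m 0 - m 1 ∧ 3 ≤ m 0 + m 1 := by omega
    simp only [h]
    interval_cases m 0 <;> interval_cases m 1 <;> simp at h' ⊢
  · simp
    omega

/-- **Proposition 4.13.** For `n ≥ 1`, the power `I(C₃)^n` of the edge ideal of the
triangle is bridge-friendly iff `n ≤ 3`. -/
theorem trianglePow_bridgeFriendly_iff (n : ℕ) (hn : 1 ≤ n) :
    BridgeFriendly (edgePowGens (SimpleGraph.cycleGraph 3) n) ↔ n ≤ 3 := by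
  constructor
  · intro h
    by_contra hn'
    exact not_bridgeFriendly_of_four_le (not_le.1 hn') h
  · intro hn'
    interval_cases n
    exacts [bridgeFriendly_one, bridgeFriendly_two, bridgeFriendly_three]

end ChauHaMaithani
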